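/- Let U : ℕ × ℤ → ℝ^r solve the semi-implicit upwind scheme with grid sizes satisfying the CFL condition, with initial total variation ∑_j |U_j^0 − U_{j−1}^0| finite and U_j^0 = 0 for all sufficiently large j, and assume Assumption (★). Then there exists a constant C > 0, independent of n, Δt, Δx and ε, such that for all n ≥ 0: ∑_{j∈ℤ} |U_j^{n+1} − U_j^n| Δx ≤ C ( (Δt/ε)(1 + λΔt/ε)^{−(n+1)} ∑_{j∈ℤ} |Q(U_j^0)| Δx + Δt ). In particular the difference solution is Lipschitz continuous in time in the discrete L¹ norm. -/

import Mathlib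

open scoped BigOperators

noncomputable section

/-- The 1-norm `|V| = ∑ i |v_i|` on `ℝ^r`. -/
def onenorm {r : ℕ} (V : Fin r → ℝ) : ℝ := ∑ i, |V i|

/-- The reaction term `Q(U) = (f_1, f_2 - f_1, …, f_i - f_{i-1}, …, -f_{r-1})`
for `U ∈ ℝ^r` with `r = m + 2`, built from `f_i = f_i (u_i, u_{i+1})`. -/
def Qr (m : ℕ) (f : Fin (m + 1) → ℝ → ℝ → ℝ) (U : Fin (m + 2) → ℝ) :
    Fin (m + 2) → ℝ :=
  fun k =>
    (∑ i : Fin (m + 1), if k = i.castSucc then f i (U i.castSucc) (U i.succ) else 0)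
      - ∑ i : Fin (m + 1), if k = i.succ then f i (U i.castSucc) (U i.succ) else 0

/-- The semi-implicit upwind scheme
`(U_j^{n+1} - U_j^n)/Δt + Λ⁺(U_j^n - U_{j-1}^n)/Δx + Λ⁻(U_{j+1}^n - U_j^n)/Δx
  = (1/ε) Q(U_j^{n+1})`,
where `λ_i^± = (λ_i ± |λ_i|)/2` and `Λ^± = diag(λ_1^±, …, λ_r^±)`. -/
def Scheme (m : ℕ) (f : Fin (m + 1) → ℝ → ℝ → ℝ) (lam : Fin (m + 2) → ℝ)
    (Δt Δx ε : ℝ) (U : ℕ → ℤ → Fin (m + 2) → ℝ) : Prop :=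
  ∀ (n : ℕ) (j : ℤ) (i : Fin (m + 2)),
    (U (n + 1) j i - U n j i) / Δt
      + (lam i + |lam i|) / 2 * (U n j i - U n (j - 1) i) / Δx
      + (lam i - |lam i|) / 2 * (U n (j + 1) i - U n j i) / Δx
    = (1 / ε) * Qr m f (U (n + 1) j) i

/-- The CFL condition `(Δt/Δx) · max_i |λ_i| ≤ 1`. -/
def CFL (m : ℕ) (lam : Fin (m + 2) → ℝ) (Δt Δx : ℝ) : Prop :=
  ∀ i, Δt / Δx * |lam i| ≤ 1

/-- `A_i(V, W) = ∫₀¹ ∂₁f_i(θv_i + (1-θ)w_i, θv_{i+1} + (1-θ)w_{i+1}) dθ`. -/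
def Aint (m : ℕ) (f : Fin (m + 1) → ℝ → ℝ → ℝ) (V W : Fin (m + 2) → ℝ)
    (i : Fin (m + 1)) : ℝ :=
  ∫ θ in (0 : ℝ)..1,
    deriv (fun v => f i v (θ * V i.succ + (1 - θ) * W i.succ))
      (θ * V i.castSucc + (1 - θ) * W i.castSucc)

/-- `B_i(V, W) = ∫₀¹ ∂₂f_i(θv_i + (1-θ)w_i, θv_{i+1} + (1-θ)w_{i+1}) dθ`. -/
def Bint (m : ℕ) (f : Fin (m + 1) → ℝ → ℝ → ℝ) (V W : Fin (m + 2) → ℝ)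
    (i : Fin (m + 1)) : ℝ :=
  ∫ θ in (0 : ℝ)..1,
    deriv (fun w => f i (θ * V i.castSucc + (1 - θ) * W i.castSucc) w)
      (θ * V i.succ + (1 - θ) * W i.succ)

/-- The `(r-1) × (r-1)` tridiagonal matrix `M(V, W)` with diagonal entries `A_i - B_i`,
superdiagonal entries `B_i` and subdiagonal entries `-A_{i+1}`. -/
def Mmat (m : ℕ) (f : Fin (m + 1) → ℝ → ℝ → ℝ) (V W : Fin (m + 2) → ℝ) :
    Matrix (Fin (m + 1)) (Fin (m + 1)) ℝ :=
  fun k l =>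
    if l = k then Aint m f V W k - Bint m f V W k
    else if (l : ℕ) = (k : ℕ) + 1 then Bint m f V W k
    else if (k : ℕ) = (l : ℕ) + 1 then -Aint m f V W k
    else 0

/-- **Assumption (★).** `N` is a norm `|·|_⋆` on `ℝ^{r-1}` and `lam0 = λ > 0` is such that
for all `V, W ∈ ℝ^r` and all `Δt, ε > 0` the matrix `I - (Δt/ε) M(V, W)` is invertible and
the `⋆`-operator norm of its inverse is at most `(1 + λΔt/ε)⁻¹`. -/
def StarAssumption (m : ℕ) (f : Fin (m + 1) → ℝ → ℝ → ℝ)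
    (N : (Fin (m + 1) → ℝ) → ℝ) (lam0 : ℝ) : Prop :=
  (∀ x, 0 ≤ N x) ∧ (∀ x, N x = 0 ↔ x = 0) ∧
  (∀ (c : ℝ) (x), N (c • x) = |c| * N x) ∧
  (∀ x y, N (x + y) ≤ N x + N y) ∧
  0 < lam0 ∧
  ∀ (V W : Fin (m + 2) → ℝ) (Δt ε : ℝ), 0 < Δt → 0 < ε →
    IsUnit (1 - (Δt / ε) • Mmat m f V W) ∧
    ∀ ξ : Fin (m + 1) → ℝ,
      N ((1 - (Δt / ε) • Mmat m f V W)⁻¹.mulVec ξ)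
        ≤ (1 + lam0 * Δt / ε)⁻¹ * N ξ

end

/-- The vector of fluxes. -/
def Fv (m : ℕ) (f : Fin (m + 1) → ℝ → ℝ → ℝ) (U : Fin (m + 2) → ℝ) : Fin (m + 1) → ℝ :=
  fun i => f i (U i.castSucc) (U i.succ)

lemma onenorm_nonneg {r : ℕ} (V : Fin r → ℝ) : 0 ≤ onenorm V :=
  Finset.sum_nonneg fun _ _ => abs_nonneg _

lemma abs_le_onenorm {r : ℕ} (V : Fin r → ℝ) (i : Fin r) : |V i| ≤ onenorm V :=
  Finset.single_le_sum (f := fun i => |V i|) (fun _ _ => abs_nonneg _) (Finset.mem_univ i)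

lemma onenorm_add_le {r : ℕ} (V W : Fin r → ℝ) : onenorm (V + W) ≤ onenorm V + onenorm W := by
  unfold onenorm
  rw [← Finset.sum_add_distrib]
  exact Finset.sum_le_sum fun i _ => abs_add_le _ _

lemma onenorm_sub_le {r : ℕ} (V W : Fin r → ℝ) : onenorm (V - W) ≤ onenorm V + onenorm W := by
  unfold onenorm
  rw [← Finset.sum_add_distrib]
  exact Finset.sum_le_sum fun i _ => abs_sub _ _

lemma onenorm_smul {r : ℕ} (c : ℝ) (V : Fin r → ℝ) : onenorm (c • V) = |c| * onenorm V := by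
  simp [onenorm, abs_mul, Finset.mul_sum]

lemma sum_mul_Qr (m : ℕ) (f : Fin (m + 1) → ℝ → ℝ → ℝ) (U g : Fin (m + 2) → ℝ) :
    ∑ k, g k * Qr m f U k = ∑ i : Fin (m + 1), (g i.castSucc - g i.succ) * Fv m f U i := by
  simp only [Qr, mul_sub, Finset.sum_sub_distrib, Finset.mul_sum, sub_mul]
  congr 1
  · rw [Finset.sum_comm]
    refine Finset.sum_congr rfl fun i _ => ?_
    simp [Fv]
  · rw [Finset.sum_comm]
    refine Finset.sum_congr rfl fun i _ => ?_
    simp [Fv]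

lemma accretive (m : ℕ) (f : Fin (m + 1) → ℝ → ℝ → ℝ)
    (hf2 : ∀ i w, StrictAnti fun v => f i v w)
    (hf3 : ∀ i v, StrictMono fun w => f i v w) (V W : Fin (m + 2) → ℝ) :
    ∑ k, Real.sign (V k - W k) * (Qr m f V k - Qr m f W k) ≤ 0 := by
  simp only [mul_sub (Real.sign _), Finset.sum_sub_distrib]
  rw [sum_mul_Qr m f V (fun k => Real.sign (V k - W k)),
    sum_mul_Qr m f W (fun k => Real.sign (V k - W k)), ← Finset.sum_sub_distrib]
  refine Finset.sum_nonpos fun i _ => ?_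
  rw [← mul_sub]
  have key : ∀ v w v' w' : ℝ, w ≤ v → v' ≤ w' → f i v v' - f i w w' ≤ 0 := by
    intro v w v' w' h1 h2
    have a1 := (hf2 i v').antitone h1
    have a2 := (hf3 i w).monotone h2
    linarith
  have key2 : ∀ v w v' w' : ℝ, v ≤ w → w' ≤ v' → 0 ≤ f i v v' - f i w w' := by
    intro v w v' w' h1 h2
    have := key w v w' v' h1 h2
    linarith
  simp only [Fv]
  generalize V i.castSucc = v
  generalize W i.castSucc = w
  generalize V i.succ = v'
  generalize W i.succ = w'
  have k1 := key v w v' w'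
  have k2 := key2 v w v' w'
  rcases lt_trichotomy v w with h | h | h <;> rcases lt_trichotomy v' w' with h' | h' | h' <;>
    (first
      | rw [Real.sign_of_neg (sub_neg.2 h)]
      | rw [Real.sign_of_pos (sub_pos.2 h)]
      | rw [sub_eq_zero.2 h, Real.sign_zero]) <;>
    (first
      | rw [Real.sign_of_neg (sub_neg.2 h')]
      | rw [Real.sign_of_pos (sub_pos.2 h')]
      | rw [sub_eq_zero.2 h', Real.sign_zero]) <;>
    first
      | (have := k1 (by linarith) (by linarith); linarith)
      | (have := k2 (by linarith) (by linarith); linarith)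
      | linarith

lemma contraction (m : ℕ) (f : Fin (m + 1) → ℝ → ℝ → ℝ)
    (hf2 : ∀ i w, StrictAnti fun v => f i v w)
    (hf3 : ∀ i v, StrictMono fun w => f i v w) (V W X Y : Fin (m + 2) → ℝ) (s : ℝ) (hs : 0 ≤ s)
    (hV : ∀ i, V i - s * Qr m f V i = X i) (hW : ∀ i, W i - s * Qr m f W i = Y i) :
    onenorm (V - W) ≤ onenorm (X - Y) := by
  have h1 : onenorm (V - W) = ∑ k, Real.sign (V k - W k) * (V k - W k) := by
    refine Finset.sum_congr rfl fun k _ => ?_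
    rw [Pi.sub_apply]
    rcases lt_trichotomy (V k - W k) 0 with h | h | h
    · rw [Real.sign_of_neg h, abs_of_neg h]; ring
    · simp [h]
    · rw [Real.sign_of_pos h, abs_of_pos h]; ring
  have h2 : ∀ k, Real.sign (V k - W k) * (V k - W k)
      ≤ |(X - Y) k| + s * (Real.sign (V k - W k) * (Qr m f V k - Qr m f W k)) := by
    intro k
    have e : V k - W k = (X - Y) k + s * (Qr m f V k - Qr m f W k) := by
      rw [Pi.sub_apply, ← hV, ← hW]; ring
    have : Real.sign (V k - W k) * (X - Y) k ≤ |(X - Y) k| := by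
      rcases Real.sign_apply_eq (V k - W k) with h | h | h <;> rw [h]
      · have := neg_abs_le ((X - Y) k); linarith
      · simp
      · have := le_abs_self ((X - Y) k); linarith
    calc Real.sign (V k - W k) * (V k - W k)
        = Real.sign (V k - W k) * ((X - Y) k + s * (Qr m f V k - Qr m f W k)) := by rw [← e]
      _ ≤ _ := by nlinarith
  rw [h1]
  refine (Finset.sum_le_sum fun k _ => h2 k).trans ?_
  rw [Finset.sum_add_distrib, ← Finset.mul_sum]
  have := mul_nonneg_of_nonpos_of_nonpos (neg_nonpos.2 hs) (accretive m f hf2 hf3 V W)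
  unfold onenorm
  linarith

lemma Qr_zero (m : ℕ) (f : Fin (m + 1) → ℝ → ℝ → ℝ) (hf0 : ∀ i, f i 0 0 = 0) :
    Qr m f 0 = 0 := by
  funext k
  simp [Qr, hf0]

lemma hasDeriv1 (g : ℝ → ℝ → ℝ) (hg : ContDiff ℝ 1 fun p : ℝ × ℝ => g p.1 p.2) (a b : ℝ) :
    HasDerivAt (fun v => g v b) (fderiv ℝ (fun p : ℝ × ℝ => g p.1 p.2) (a, b) (1, 0)) a := by
  have h := ((hg.differentiable (by norm_num)) (a, b)).hasFDerivAt
  have h2 : HasDerivAt (fun v : ℝ => (v, b)) ((1 : ℝ), (0 : ℝ)) a :=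
    (hasDerivAt_id a).prodMk (hasDerivAt_const a b)
  exact h.comp_hasDerivAt a h2

lemma hasDeriv2 (g : ℝ → ℝ → ℝ) (hg : ContDiff ℝ 1 fun p : ℝ × ℝ => g p.1 p.2) (a b : ℝ) :
    HasDerivAt (fun w => g a w) (fderiv ℝ (fun p : ℝ × ℝ => g p.1 p.2) (a, b) (0, 1)) b := by
  have h := ((hg.differentiable (by norm_num)) (a, b)).hasFDerivAt
  have h2 : HasDerivAt (fun w : ℝ => (a, w)) ((0 : ℝ), (1 : ℝ)) b :=
    (hasDerivAt_const b a).prodMk (hasDerivAt_id b)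
  exact h.comp_hasDerivAt b h2

lemma f_diff (m : ℕ) (f : Fin (m + 1) → ℝ → ℝ → ℝ)
    (hf1 : ∀ i, ContDiff ℝ 1 fun p : ℝ × ℝ => f i p.1 p.2) (V W : Fin (m + 2) → ℝ)
    (i : Fin (m + 1)) :
    Fv m f V i - Fv m f W i = Aint m f V W i * (V i.castSucc - W i.castSucc)
      + Bint m f V W i * (V i.succ - W i.succ) := by
  simp only [Fv, Aint, Bint]
  simp only [fun a b => (hasDeriv1 (f i) (hf1 i) a b).deriv,
    fun a b => (hasDeriv2 (f i) (hf1 i) a b).deriv]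
  generalize V i.castSucc = v
  generalize W i.castSucc = w
  generalize V i.succ = v'
  generalize W i.succ = w'
  have hc : Continuous (fun p => fderiv ℝ (fun p : ℝ × ℝ => f i p.1 p.2) p) :=
    (hf1 i).continuous_fderiv (by norm_num)
  have hc1 : Continuous (fun θ : ℝ => fderiv ℝ (fun p : ℝ × ℝ => f i p.1 p.2)
      (θ * v + (1 - θ) * w, θ * v' + (1 - θ) * w')) := hc.comp (by fun_prop)
  have c1 := hc1.clm_apply (continuous_const (y := ((1 : ℝ), (0 : ℝ))))
  have c2 := hc1.clm_apply (continuous_const (y := ((0 : ℝ), (1 : ℝ))))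
  have d1 := c1.mul (continuous_const (y := v - w))
  have d2 := c2.mul (continuous_const (y := v' - w'))
  rw [← intervalIntegral.integral_mul_const, ← intervalIntegral.integral_mul_const,
    ← intervalIntegral.integral_add (by exact d1.intervalIntegrable _ _)
      (by exact d2.intervalIntegrable _ _),
    intervalIntegral.integral_eq_sub_of_hasDerivAt
      (f := fun θ : ℝ => f i (θ * v + (1 - θ) * w) (θ * v' + (1 - θ) * w'))]
  · simp
  · intro θ _
    have h := ((hf1 i).differentiable (by norm_num)
      (θ * v + (1 - θ) * w, θ * v' + (1 - θ) * w')).hasFDerivAt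
    have l : ∀ a b : ℝ, HasDerivAt (fun θ : ℝ => θ * a + (1 - θ) * b) (a - b) θ := by
      intro a b
      have := ((hasDerivAt_id θ).mul_const a).add
        (((hasDerivAt_const θ (1 : ℝ)).sub (hasDerivAt_id θ)).mul_const b)
      exact this.congr_deriv (by ring)
    have h3 := h.comp_hasDerivAt θ ((l v w).prodMk (l v' w'))
    refine HasDerivAt.congr_deriv h3 ?_
    have e : ((v - w, v' - w') : ℝ × ℝ) = (v - w) • ((1 : ℝ), (0 : ℝ)) + (v' - w') • ((0 : ℝ), (1 : ℝ)) := by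
      simp
    rw [e, map_add, map_smul, map_smul, smul_eq_mul, smul_eq_mul]
    ring
  · exact (d1.add d2).intervalIntegrable _ _

lemma AB_bound (m : ℕ) (f : Fin (m + 1) → ℝ → ℝ → ℝ)
    (hf1 : ∀ i, ContDiff ℝ 1 fun p : ℝ × ℝ => f i p.1 p.2) (T : ℝ) :
    ∃ K : ℝ, 0 ≤ K ∧ ∀ V W : Fin (m + 2) → ℝ, (∀ k, |V k| ≤ T) → (∀ k, |W k| ≤ T) →
      ∀ i, |Aint m f V W i| ≤ K ∧ |Bint m f V W i| ≤ K := by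
  have h1 : ∀ i, ∃ C, ∀ p ∈ (Set.Icc (-T) T ×ˢ Set.Icc (-T) T : Set (ℝ × ℝ)),
      ‖fderiv ℝ (fun p : ℝ × ℝ => f i p.1 p.2) p‖ ≤ C := fun i =>
    (isCompact_Icc.prod isCompact_Icc).exists_bound_of_continuousOn
      ((hf1 i).continuous_fderiv (by norm_num)).continuousOn
  choose C hC using h1
  refine ⟨∑ i, |C i|, Finset.sum_nonneg fun _ _ => abs_nonneg _, fun V W hV hW i => ?_⟩
  have hle : C i ≤ ∑ i, |C i| := (le_abs_self _).trans
    (Finset.single_le_sum (f := fun i => |C i|) (fun _ _ => abs_nonneg _) (Finset.mem_univ i))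
  have conv : ∀ k, ∀ θ ∈ Set.uIoc (0 : ℝ) 1, θ * V k + (1 - θ) * W k ∈ Set.Icc (-T) T := by
    intro k θ hθ
    rw [Set.uIoc_of_le zero_le_one] at hθ
    have a := abs_le.1 (hV k)
    have b := abs_le.1 (hW k)
    constructor <;> nlinarith [hθ.1, hθ.2]
  have n1 : ‖((1 : ℝ), (0 : ℝ))‖ ≤ 1 := by simp [Prod.norm_def]
  have n2 : ‖((0 : ℝ), (1 : ℝ))‖ ≤ 1 := by simp [Prod.norm_def]
  simp only [Aint, Bint]
  simp only [fun a b => (hasDeriv1 (f i) (hf1 i) a b).deriv,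
    fun a b => (hasDeriv2 (f i) (hf1 i) a b).deriv]
  constructor
  · rw [← Real.norm_eq_abs]
    refine (intervalIntegral.norm_integral_le_of_norm_le_const (a := 0) (b := 1) (C := C i)
      fun θ hθ => ?_).trans (le_of_eq_of_le (b := C i) (by norm_num) hle)
    refine (ContinuousLinearMap.le_opNorm _ _).trans ?_
    have := hC i _ (Set.mk_mem_prod (conv i.castSucc θ hθ) (conv i.succ θ hθ))
    nlinarith [norm_nonneg (fderiv ℝ (fun p : ℝ × ℝ => f i p.1 p.2) (θ * V i.castSucc + (1 - θ) * W i.castSucc, θ * V i.succ + (1 - θ) * W i.succ))]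
  · rw [← Real.norm_eq_abs]
    refine (intervalIntegral.norm_integral_le_of_norm_le_const (a := 0) (b := 1) (C := C i)
      fun θ hθ => ?_).trans (le_of_eq_of_le (b := C i) (by norm_num) hle)
    refine (ContinuousLinearMap.le_opNorm _ _).trans ?_
    have := hC i _ (Set.mk_mem_prod (conv i.castSucc θ hθ) (conv i.succ θ hθ))
    nlinarith [norm_nonneg (fderiv ℝ (fun p : ℝ × ℝ => f i p.1 p.2) (θ * V i.castSucc + (1 - θ) * W i.castSucc, θ * V i.succ + (1 - θ) * W i.succ))]

lemma M_mulVec (m : ℕ) (f : Fin (m + 1) → ℝ → ℝ → ℝ) (V W U : Fin (m + 2) → ℝ)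
    (k : Fin (m + 1)) :
    (Mmat m f V W).mulVec (Fv m f U) k
      = Aint m f V W k * Qr m f U k.castSucc + Bint m f V W k * Qr m f U k.succ := by
  simp only [Matrix.mulVec, dotProduct, Qr]
  rw [← Finset.sum_sub_distrib, ← Finset.sum_sub_distrib, Finset.mul_sum, Finset.mul_sum,
    ← Finset.sum_add_distrib]
  refine Finset.sum_congr rfl fun l _ => ?_
  simp only [Mmat, Fv, Fin.ext_iff, Fin.val_castSucc, Fin.val_succ]
  split_ifs <;> first | omega | ring

lemma N_equiv {d : ℕ} (N : (Fin d → ℝ) → ℝ) (h0 : ∀ x, 0 ≤ N x)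
    (h1 : ∀ x, N x = 0 ↔ x = 0) (h2 : ∀ (c : ℝ) (x), N (c • x) = |c| * N x)
    (h3 : ∀ x y, N (x + y) ≤ N x + N y) :
    ∃ a b : ℝ, 0 < a ∧ 0 < b ∧ (∀ x, N x ≤ a * onenorm x) ∧ ∀ x, onenorm x ≤ b * N x := by
  have hsum : ∀ (s : Finset (Fin d)) (g : Fin d → (Fin d → ℝ)),
      N (∑ i ∈ s, g i) ≤ ∑ i ∈ s, N (g i) := by
    intro s g
    induction s using Finset.induction_on with
    | empty => simp [(h1 0).2 rfl]
    | insert a s ha ih =>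
      rw [Finset.sum_insert ha, Finset.sum_insert ha]
      exact (h3 _ _).trans (by linarith)
  set a : ℝ := 1 + ∑ i, N (Pi.single i 1) with ha
  have hi : ∀ i, N (Pi.single i (1 : ℝ)) ≤ a := by
    intro i
    have := Finset.single_le_sum (f := fun i => N (Pi.single i (1 : ℝ))) (fun _ _ => h0 _) (Finset.mem_univ i)
    linarith
  have ha0 : 0 < a := by
    have : 0 ≤ ∑ i, N (Pi.single i (1 : ℝ)) := Finset.sum_nonneg fun _ _ => h0 _
    linarith
  have hup : ∀ x, N x ≤ a * onenorm x := by
    intro x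
    have hx : x = ∑ i, x i • (Pi.single i (1 : ℝ) : Fin d → ℝ) := by
      funext k
      simp [Finset.sum_apply, Pi.single_apply]
    calc N x = N (∑ i, x i • (Pi.single i (1 : ℝ) : Fin d → ℝ)) := by rw [← hx]
      _ ≤ ∑ i, N (x i • (Pi.single i (1 : ℝ) : Fin d → ℝ)) := hsum _ _
      _ ≤ ∑ i, a * |x i| := by
          refine Finset.sum_le_sum fun i _ => ?_
          rw [h2, mul_comm]
          exact mul_le_mul_of_nonneg_right (hi i) (abs_nonneg _)
      _ = _ := by rw [onenorm, Finset.mul_sum]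
  have hone : Continuous (fun x : Fin d → ℝ => onenorm x) := by
    unfold onenorm; fun_prop
  have hcont : Continuous N := by
    rw [continuous_iff_continuousAt]
    intro x
    have hz : Filter.Tendsto (fun y : Fin d → ℝ => a * onenorm (y - x)) (nhds x) (nhds 0) := by
      have : Continuous (fun y : Fin d → ℝ => a * onenorm (y - x)) :=
        continuous_const.mul (hone.comp (by fun_prop))
      have h := this.tendsto x
      simpa [onenorm] using h
    rw [ContinuousAt, tendsto_iff_dist_tendsto_zero]
    refine squeeze_zero (fun _ => dist_nonneg) (fun y => ?_) hz
    rw [Real.dist_eq, abs_le]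
    have e1 := h3 (y - x) x
    have e2 := h3 (x - y) y
    have e3 : N (x - y) = N (y - x) := by
      have := h2 (-1) (y - x)
      simpa using this
    have e4 := hup (y - x)
    rw [sub_add_cancel] at e1 e2
    constructor <;> linarith
  set S : Set (Fin d → ℝ) := {x | onenorm x = 1} with hS
  have hScl : IsClosed S := isClosed_eq hone continuous_const
  have hSc : IsCompact S := by
    refine Metric.isCompact_of_isClosed_isBounded hScl ?_
    refine (Metric.isBounded_closedBall (x := (0 : Fin d → ℝ)) (r := 1)).subset fun x hx => ?_
    rw [mem_closedBall_zero_iff, pi_norm_le_iff_of_nonneg zero_le_one]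
    intro i
    have := abs_le_onenorm x i
    rw [show onenorm x = 1 from hx] at this
    exact this
  rcases S.eq_empty_or_nonempty with he | hne
  · refine ⟨a, 1, ha0, one_pos, hup, fun x => ?_⟩
    by_contra hx
    push Not at hx
    have hp : 0 < onenorm x := lt_of_le_of_lt (by have := h0 x; linarith) hx
    have : (onenorm x)⁻¹ • x ∈ S := by
      rw [hS, Set.mem_ofPred_eq, onenorm_smul, abs_of_pos (inv_pos.2 hp), inv_mul_cancel₀ hp.ne']
    rw [he] at this
    exact this
  · obtain ⟨x0, hx0, hmin⟩ := hSc.exists_isMinOn hne hcont.continuousOn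
    have hpos : 0 < N x0 := by
      refine lt_of_le_of_ne (h0 _) fun h => ?_
      have := (h1 x0).1 h.symm
      rw [this] at hx0
      simp [hS, onenorm] at hx0
    refine ⟨a, (N x0)⁻¹, ha0, inv_pos.2 hpos, hup, fun x => ?_⟩
    rcases (onenorm_nonneg x).eq_or_lt with h | hp
    · rw [← h]; exact mul_nonneg (inv_pos.2 hpos).le (h0 _)
    · have hm : (onenorm x)⁻¹ • x ∈ S := by
        rw [hS, Set.mem_ofPred_eq, onenorm_smul, abs_of_pos (inv_pos.2 hp), inv_mul_cancel₀ hp.ne']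
      have := hmin hm
      simp only [Set.mem_ofPred_eq] at this
      rw [h2, abs_of_pos (inv_pos.2 hp), inv_mul_eq_div, le_div_iff₀ hp] at this
      rw [inv_mul_eq_div, le_div_iff₀ hpos]
      linarith

/-- Transport increment. -/
noncomputable def Tr {d : ℕ} (lam : Fin d → ℝ) (c : ℝ) (U : ℤ → Fin d → ℝ) (j : ℤ) : Fin d → ℝ :=
  fun i => c * ((lam i + |lam i|) / 2 * (U j i - U (j - 1) i)
    + (lam i - |lam i|) / 2 * (U (j + 1) i - U j i))

lemma scheme_eq {m : ℕ} {f : Fin (m + 1) → ℝ → ℝ → ℝ} {lam : Fin (m + 2) → ℝ}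
    {Δt Δx ε : ℝ} (ht : 0 < Δt) {U : ℕ → ℤ → Fin (m + 2) → ℝ}
    (h : Scheme m f lam Δt Δx ε U) (n : ℕ) (j : ℤ) (i : Fin (m + 2)) :
    U (n + 1) j i - Δt / ε * Qr m f (U (n + 1) j) i
      = U n j i - Tr lam (Δt / Δx) (U n) j i := by
  have h1 := congrArg (fun x => Δt * x) (h n j i)
  simp only [mul_add] at h1
  rw [mul_div_cancel₀ _ ht.ne'] at h1
  unfold Tr
  have e : Δt / ε * Qr m f (U (n + 1) j) i = Δt * (1 / ε * Qr m f (U (n + 1) j) i) := by ring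
  rw [e, ← h1]
  ring

lemma hasSum_shift {D : ℤ → ℝ} {S : ℝ} (h : HasSum D S) (k : ℤ) :
    HasSum (fun j => D (j + k)) S :=
  (Equiv.addRight k).hasSum_iff.2 h

lemma comp_hasSum {d : ℕ} {U : ℤ → Fin d → ℝ}
    (h : Summable fun j => onenorm (U j - U (j - 1))) :
    ∃ S : Fin d → ℝ, (∀ i, HasSum (fun j => |U j i - U (j - 1) i|) (S i)) ∧
      ∑' j, onenorm (U j - U (j - 1)) = ∑ i, S i := by
  have hs : ∀ i, Summable (fun j => |U j i - U (j - 1) i|) := fun i =>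
    Summable.of_nonneg_of_le (fun _ => abs_nonneg _)
      (fun j => abs_le_onenorm (U j - U (j - 1)) i) h
  refine ⟨fun i => ∑' j, |U j i - U (j - 1) i|, fun i => (hs i).hasSum, ?_⟩
  exact (hasSum_sum fun i _ => (hs i).hasSum).tsum_eq

lemma tv_step (m : ℕ) (f : Fin (m + 1) → ℝ → ℝ → ℝ)
    (hf2 : ∀ i w, StrictAnti fun v => f i v w)
    (hf3 : ∀ i v, StrictMono fun w => f i v w) (lam : Fin (m + 2) → ℝ) (s c : ℝ) (hs : 0 ≤ s)
    (hc : 0 ≤ c) (hcfl : ∀ i, c * |lam i| ≤ 1) (U V : ℤ → Fin (m + 2) → ℝ)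
    (hV : ∀ j i, V j i - s * Qr m f (V j) i = U j i - Tr lam c U j i)
    (hU : Summable fun j => onenorm (U j - U (j - 1))) :
    (Summable fun j => onenorm (V j - V (j - 1))) ∧
    ∑' j, onenorm (V j - V (j - 1)) ≤ ∑' j, onenorm (U j - U (j - 1)) := by
  obtain ⟨S, hS, hST⟩ := comp_hasSum hU
  have hp : ∀ i, 0 ≤ (lam i + |lam i|) / 2 := fun i => by
    have := neg_abs_le (lam i); linarith
  have hn : ∀ i, 0 ≤ (|lam i| - lam i) / 2 := fun i => by
    have := le_abs_self (lam i); linarith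
  have hb : ∀ j, onenorm (V j - V (j - 1)) ≤ ∑ i, ((1 - c * |lam i|) * |U j i - U (j - 1) i|
      + c * ((lam i + |lam i|) / 2) * |U (j + -1) i - U (j + -1 - 1) i|
      + c * ((|lam i| - lam i) / 2) * |U (j + 1) i - U (j + 1 - 1) i|) := by
    intro j
    refine (contraction m f hf2 hf3 (V j) (V (j - 1)) (fun i => U j i - Tr lam c U j i)
      (fun i => U (j - 1) i - Tr lam c U (j - 1) i) s hs (hV j) (hV (j - 1))).trans ?_
    refine Finset.sum_le_sum fun i _ => ?_
    have e : ((fun i => U j i - Tr lam c U j i) - fun i => U (j - 1) i - Tr lam c U (j - 1) i) i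
      = (1 - c * |lam i|) * (U j i - U (j - 1) i)
      + c * ((lam i + |lam i|) / 2) * (U (j + -1) i - U (j + -1 - 1) i)
      + c * ((|lam i| - lam i) / 2) * (U (j + 1) i - U (j + 1 - 1) i) := by
      simp only [Tr, Pi.sub_apply, sub_add_cancel, add_sub_cancel_right, ← sub_eq_add_neg]
      ring
    rw [e]
    refine (abs_add_three _ _ _).trans ?_
    rw [abs_mul (1 - c * |lam i|), abs_mul (c * ((lam i + |lam i|) / 2)),
      abs_mul (c * ((|lam i| - lam i) / 2)), abs_of_nonneg (sub_nonneg.2 (hcfl i)),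
      abs_of_nonneg (mul_nonneg hc (hp i)), abs_of_nonneg (mul_nonneg hc (hn i))]
  have hsum := hasSum_sum (s := Finset.univ) fun i _ =>
    (((hS i).mul_left (1 - c * |lam i|)).add
      ((hasSum_shift (hS i) (-1)).mul_left (c * ((lam i + |lam i|) / 2)))).add
      ((hasSum_shift (hS i) 1).mul_left (c * ((|lam i| - lam i) / 2)))
  have hVs : Summable fun j => onenorm (V j - V (j - 1)) :=
    Summable.of_nonneg_of_le (fun _ => onenorm_nonneg _) hb hsum.summable
  refine ⟨hVs, ?_⟩
  refine (hVs.tsum_le_tsum hb hsum.summable).trans (le_of_eq ?_)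
  rw [hsum.tsum_eq, hST]
  refine Finset.sum_congr rfl fun i _ => ?_
  ring

lemma Tr_sum {d : ℕ} (lam : Fin d → ℝ) (c : ℝ) (hc : 0 ≤ c) (U : ℤ → Fin d → ℝ)
    (hU : Summable fun j => onenorm (U j - U (j - 1))) :
    (Summable fun j => onenorm (Tr lam c U j)) ∧
    ∑' j, onenorm (Tr lam c U j) ≤
      c * (2 * onenorm lam) * ∑' j, onenorm (U j - U (j - 1)) := by
  have hb : ∀ j, onenorm (Tr lam c U j) ≤ c * onenorm lam * onenorm (U j - U (j - 1))
      + c * onenorm lam * onenorm (U (j + 1) - U (j + 1 - 1)) := by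
    intro j
    have hL := abs_le_onenorm lam
    generalize onenorm lam = L at hL ⊢
    unfold onenorm
    rw [Finset.mul_sum, Finset.mul_sum, ← Finset.sum_add_distrib]
    refine Finset.sum_le_sum fun i _ => ?_
    have h := hL i
    have h1 := neg_abs_le (lam i)
    have h2 := le_abs_self (lam i)
    have g1 : |(lam i + |lam i|) / 2| ≤ L := by
      rw [abs_of_nonneg (by linarith)]; linarith
    have g2 : |(lam i - |lam i|) / 2| ≤ L := by
      rw [abs_of_nonpos (by linarith)]; linarith
    simp only [Tr, Pi.sub_apply, add_sub_cancel_right]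
    rw [abs_mul, abs_of_nonneg hc, mul_assoc, mul_assoc, ← mul_add]
    refine mul_le_mul_of_nonneg_left ((abs_add_le _ _).trans ?_) hc
    rw [abs_mul, abs_mul]
    exact add_le_add (mul_le_mul_of_nonneg_right g1 (abs_nonneg _))
      (mul_le_mul_of_nonneg_right g2 (abs_nonneg _))
  have hsum := (hU.hasSum.mul_left (c * onenorm lam)).add
    ((hasSum_shift hU.hasSum 1).mul_left (c * onenorm lam))
  have hs : Summable fun j => onenorm (Tr lam c U j) :=
    Summable.of_nonneg_of_le (fun _ => onenorm_nonneg _) hb hsum.summable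
  refine ⟨hs, (hs.tsum_le_tsum hb hsum.summable).trans (le_of_eq ?_)⟩
  rw [hsum.tsum_eq]
  ring

lemma sup_bound {d : ℕ} (U : ℤ → Fin d → ℝ) (J : ℤ) (hJ : ∀ j > J, U j = 0)
    (hU : Summable fun j => onenorm (U j - U (j - 1))) (j : ℤ) :
    onenorm (U j) ≤ ∑' j, onenorm (U j - U (j - 1)) := by
  have h1 : ∀ n : ℕ, onenorm (U j) ≤
      ∑ k ∈ Finset.range n, onenorm (U (j + k + 1) - U (j + k + 1 - 1)) + onenorm (U (j + n)) := by
    intro n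
    induction n with
    | zero => simp
    | succ n ih =>
      rw [Finset.sum_range_succ]
      have := onenorm_sub_le (U (j + n + 1)) (U (j + n + 1) - U (j + n + 1 - 1))
      rw [sub_sub_cancel, add_sub_cancel_right] at this
      push_cast
      rw [← add_assoc]
      rw [add_sub_cancel_right (j + (n : ℤ)) 1]
      linarith
  have h2 := h1 (J - j + 1).toNat
  have h3 : U (j + ((J - j + 1).toNat : ℤ)) = 0 := hJ _ (by omega)
  rw [h3] at h2
  refine h2.trans ?_
  have h4 : onenorm (0 : Fin d → ℝ) = 0 := by simp [onenorm]
  rw [h4, add_zero]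
  have := Finset.sum_image (s := Finset.range (J - j + 1).toNat) (g := fun k : ℕ => j + k + 1)
    (f := fun j => onenorm (U j - U (j - 1))) (by intro a _ b _ h; simpa using h)
  rw [← this]
  exact hU.sum_le_tsum _ (fun _ _ => onenorm_nonneg _)

lemma onenorm_Qr_le (m : ℕ) (f : Fin (m + 1) → ℝ → ℝ → ℝ) (U : Fin (m + 2) → ℝ) :
    onenorm (Qr m f U) ≤ 2 * onenorm (Fv m f U) := by
  have h1 : onenorm (Qr m f U) = ∑ k, Real.sign (Qr m f U k) * Qr m f U k := by
    refine Finset.sum_congr rfl fun k _ => ?_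
    rcases lt_trichotomy (Qr m f U k) 0 with h | h | h
    · rw [Real.sign_of_neg h, abs_of_neg h]; ring
    · simp [h]
    · rw [Real.sign_of_pos h, abs_of_pos h]; ring
  rw [h1, sum_mul_Qr m f U (fun k => Real.sign (Qr m f U k)), onenorm, Finset.mul_sum]
  refine Finset.sum_le_sum fun i _ => ?_
  have hp := le_abs_self (Fv m f U i)
  have hn := neg_abs_le (Fv m f U i)
  have h0 := abs_nonneg (Fv m f U i)
  rcases Real.sign_apply_eq (Qr m f U i.castSucc) with h | h | h <;>
  rcases Real.sign_apply_eq (Qr m f U i.succ) with h' | h' | h' <;> rw [h, h'] <;> linarith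

lemma onenorm_Fv_le (m : ℕ) (f : Fin (m + 1) → ℝ → ℝ → ℝ) (U : Fin (m + 2) → ℝ) :
    onenorm (Fv m f U) ≤ (m + 1) * onenorm (Qr m f U) := by
  have h : ∀ i, |Fv m f U i| ≤ onenorm (Qr m f U) := by
    intro i
    have h1 := sum_mul_Qr m f U (fun k => if (k : ℕ) ≤ i then 1 else 0)
    have h2 : ∑ l : Fin (m + 1), ((if (l.castSucc : ℕ) ≤ i then (1 : ℝ) else 0)
        - (if (l.succ : ℕ) ≤ i then 1 else 0)) * Fv m f U l = Fv m f U i := by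
      rw [Finset.sum_eq_single i]
      · simp
      · intro l _ hl
        have : (l : ℕ) ≠ i := fun h => hl (Fin.ext h)
        simp only [Fin.val_castSucc, Fin.val_succ]
        split_ifs <;> first | omega | simp
      · simp
    rw [h2] at h1
    rw [← h1]
    refine (Finset.abs_sum_le_sum_abs _ _).trans (Finset.sum_le_sum fun k _ => ?_)
    split_ifs <;> simp
  calc onenorm (Fv m f U) ≤ ∑ _i : Fin (m + 1), onenorm (Qr m f U) :=
        Finset.sum_le_sum fun i _ => h i
    _ = _ := by simp

lemma F_step (m : ℕ) (f : Fin (m + 1) → ℝ → ℝ → ℝ)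
    (hf1 : ∀ i, ContDiff ℝ 1 fun p : ℝ × ℝ => f i p.1 p.2)
    (N : (Fin (m + 1) → ℝ) → ℝ) (lam0 : ℝ) (hstar : StarAssumption m f N lam0)
    (a : ℝ) (ha : 0 < a) (hNa : ∀ x, N x ≤ a * onenorm x) (Δt ε : ℝ) (ht : 0 < Δt) (hε : 0 < ε)
    (V W T : Fin (m + 2) → ℝ) (K : ℝ)
    (hK : ∀ i, |Aint m f V W i| ≤ K ∧ |Bint m f V W i| ≤ K)
    (hV : ∀ i, V i - Δt / ε * Qr m f V i = W i - T i) :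
    N (Fv m f V) ≤ (1 + lam0 * Δt / ε)⁻¹ *
      (N (Fv m f W) + a * ((m + 1) * (2 * K)) * onenorm T) := by
  obtain ⟨h0, -, h2, h3, hl, h5⟩ := hstar
  obtain ⟨hu, hinv⟩ := h5 V W Δt ε ht hε
  set R : Fin (m + 1) → ℝ := fun i => -(Aint m f V W i * T i.castSucc + Bint m f V W i * T i.succ)
    with hR
  have e : (1 - (Δt / ε) • Mmat m f V W).mulVec (Fv m f V) = Fv m f W + R := by
    funext i
    rw [Matrix.sub_mulVec, Matrix.one_mulVec, Matrix.smul_mulVec, Pi.sub_apply, Pi.smul_apply,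
      M_mulVec, Pi.add_apply, smul_eq_mul]
    have h := f_diff m f hf1 V W i
    have v1 : V i.castSucc - W i.castSucc = Δt / ε * Qr m f V i.castSucc - T i.castSucc := by
      have := hV i.castSucc; linarith
    have v2 : V i.succ - W i.succ = Δt / ε * Qr m f V i.succ - T i.succ := by
      have := hV i.succ; linarith
    rw [v1, v2] at h
    simp only [hR]
    linarith
  have e2 : (1 - (Δt / ε) • Mmat m f V W)⁻¹.mulVec (Fv m f W + R) = Fv m f V := by
    rw [← e, Matrix.mulVec_mulVec, Matrix.nonsing_inv_mul _
      ((Matrix.isUnit_iff_isUnit_det _).1 hu), Matrix.one_mulVec]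
  have h6 := hinv (Fv m f W + R)
  rw [e2] at h6
  refine h6.trans (mul_le_mul_of_nonneg_left ((h3 _ _).trans ?_) (by positivity))
  refine add_le_add le_rfl ((hNa R).trans ?_)
  rw [mul_assoc]
  refine mul_le_mul_of_nonneg_left ?_ ha.le
  calc onenorm R ≤ ∑ _i : Fin (m + 1), 2 * K * onenorm T := by
        refine Finset.sum_le_sum fun i _ => ?_
        rw [hR, abs_neg]
        refine (abs_add_le _ _).trans ?_
        rw [abs_mul, abs_mul]
        have a1 := mul_le_mul (hK i).1 (abs_le_onenorm T i.castSucc) (abs_nonneg _)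
          ((abs_nonneg _).trans (hK i).1)
        have a2 := mul_le_mul (hK i).2 (abs_le_onenorm T i.succ) (abs_nonneg _)
          ((abs_nonneg _).trans (hK i).1)
        linarith
    _ = _ := by simp; ring

/-- **time-Lipschitz continuity.** Let `U` solve the semi-implicit upwind
scheme with grid sizes satisfying the CFL condition, with finite initial total variation
(bounded by `TV₀`), `U_j^0 = 0` for all sufficiently large `j`, and `∑_j |Q(U_j^0)| < ∞`;
assume Assumption (★).  Then there is a constant `C > 0`, independent of `n`, `Δt`, `Δx`,
`ε`, such that for all `n ≥ 0`:
`∑_{j} |U_j^{n+1} - U_j^n| Δx ≤ C ((Δt/ε)(1 + λΔt/ε)^{-(n+1)} ∑_{j} |Q(U_j^0)| Δx + Δt)`. -/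
theorem stmt12 (m : ℕ) (f : Fin (m + 1) → ℝ → ℝ → ℝ)
    (hf1 : ∀ i, ContDiff ℝ 1 fun p : ℝ × ℝ => f i p.1 p.2)
    (hf2 : ∀ i w, StrictAnti fun v => f i v w)
    (hf3 : ∀ i v, StrictMono fun w => f i v w)
    (hf0 : ∀ i, f i 0 0 = 0)
    (lam : Fin (m + 2) → ℝ)
    (N : (Fin (m + 1) → ℝ) → ℝ) (lam0 : ℝ)
    (hstar : StarAssumption m f N lam0)
    (TV₀ : ℝ) :
    ∃ C > (0 : ℝ), ∀ (Δt Δx ε : ℝ), 0 < Δt → 0 < Δx → 0 < ε →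
      ∀ U : ℕ → ℤ → Fin (m + 2) → ℝ,
        Scheme m f lam Δt Δx ε U → CFL m lam Δt Δx →
        Summable (fun j : ℤ => onenorm (U 0 j - U 0 (j - 1))) →
        (∑' j : ℤ, onenorm (U 0 j - U 0 (j - 1))) ≤ TV₀ →
        (∃ J₀ : ℤ, ∀ j > J₀, U 0 j = 0) →
        Summable (fun j : ℤ => onenorm (Qr m f (U 0 j))) →
        ∀ n : ℕ,
          Summable (fun j : ℤ => onenorm (U (n + 1) j - U n j)) ∧
          (∑' j : ℤ, onenorm (U (n + 1) j - U n j) * Δx)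
            ≤ C * (Δt / ε * ((1 + lam0 * Δt / ε) ^ (n + 1))⁻¹
                * (∑' j : ℤ, onenorm (Qr m f (U 0 j)) * Δx) + Δt) := by
  obtain ⟨h0, h1, h2, h3, hl, h5⟩ := id hstar
  obtain ⟨a, b, ha, hb, hNa, hNb⟩ := N_equiv N h0 h1 h2 h3
  set T := |TV₀| with hT
  have hT0 : 0 ≤ T := abs_nonneg _
  obtain ⟨K, hK0, hK⟩ := AB_bound m f hf1 T
  set L := onenorm lam with hL
  have hL0 : 0 ≤ L := onenorm_nonneg _
  set C1 : ℝ := 2 * b * (a * (m + 1)) with hC1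
  set C2 : ℝ := 2 * b * (a * ((m + 1) * (2 * K)) * (2 * L * T)) / lam0 + 2 * L * T with hC2
  have hC1p : 0 ≤ C1 := by positivity
  have hC2p : 0 ≤ C2 := by positivity
  refine ⟨C1 + C2 + 1, by positivity, ?_⟩
  intro Δt Δx ε ht hx hε U hsch hcfl hTVs hTV hJ hQ n
  obtain ⟨J₀, hJ₀⟩ := hJ
  set c := Δt / Δx with hc
  set s := Δt / ε with hs
  have hc0 : 0 < c := div_pos ht hx
  have hs0 : 0 < s := div_pos ht hε
  have heq := scheme_eq ht hsch
  -- total variation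
  have htv : ∀ n, (Summable fun j => onenorm (U n j - U n (j - 1))) ∧
      ∑' j, onenorm (U n j - U n (j - 1)) ≤ T := by
    intro n
    induction n with
    | zero => exact ⟨hTVs, hTV.trans (le_abs_self _)⟩
    | succ n ih =>
      have := tv_step m f hf2 hf3 lam s c hs0.le hc0.le hcfl (U n) (U (n + 1)) (heq n) ih.1
      exact ⟨this.1, this.2.trans ih.2⟩
  -- support
  have hsup : ∀ n : ℕ, ∀ j > J₀ + n, U n j = 0 := by
    intro n
    induction n with
    | zero => simpa using hJ₀
    | succ n ih =>
      intro j hj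
      push_cast at hj
      have e0 := ih j (by linarith)
      have e1 := ih (j - 1) (by linarith)
      have e2 := ih (j + 1) (by linarith)
      have := contraction m f hf2 hf3 (U (n + 1) j) 0 0 0 s hs0.le
        (by intro i; rw [heq n j i]; simp [Tr, e0, e1, e2])
        (by intro i; simp [Qr_zero m f hf0])
      have hz : onenorm (U (n + 1) j) ≤ 0 := by simpa [onenorm] using this
      funext i
      exact abs_nonpos_iff.1 ((abs_le_onenorm _ i).trans hz)
  have hbd : ∀ n j k, |U n j k| ≤ T := fun n j k =>
    (abs_le_onenorm _ k).trans ((sup_bound (U n) _ (hsup n) (htv n).1 j).trans (htv n).2)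
  have htr : ∀ n, (Summable fun j => onenorm (Tr lam c (U n) j)) ∧
      ∑' j, onenorm (Tr lam c (U n) j) ≤ c * (2 * L * T) := by
    intro n
    obtain ⟨x1, x2⟩ := Tr_sum lam c hc0.le (U n) (htv n).1
    refine ⟨x1, x2.trans ?_⟩
    have := mul_le_mul_of_nonneg_left (htv n).2 (show 0 ≤ c * (2 * onenorm lam) by positivity)
    rw [← hL] at this ⊢
    linarith
  -- fluxes
  set ρ := 1 + lam0 * Δt / ε with hρ
  have hρs : ρ - 1 = lam0 * s := by rw [hρ, hs]; ring
  have hls : 0 < lam0 * s := mul_pos hl hs0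
  have hρ0 : 0 < ρ := by linarith
  set G : ℝ := a * ((m + 1) * (2 * K)) with hG
  have hG0 : 0 ≤ G := by positivity
  set P : ℝ := G * (c * (2 * L * T)) with hP
  set Q0 : ℝ := ∑' j, onenorm (Qr m f (U 0 j)) with hQ0
  have hstep : ∀ n j, N (Fv m f (U (n + 1) j)) ≤
      ρ⁻¹ * (N (Fv m f (U n j)) + G * onenorm (Tr lam c (U n) j)) := by
    intro n j
    exact F_step m f hf1 N lam0 hstar a ha hNa Δt ε ht hε (U (n + 1) j) (U n j) _ K
      (hK _ _ (hbd _ _) (hbd _ _)) (heq n j)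
  have hF : ∀ n, (Summable fun j => N (Fv m f (U n j))) ∧
      ∑' j, N (Fv m f (U n j)) ≤ (ρ ^ n)⁻¹ * (a * (m + 1) * Q0) + P / (lam0 * s) := by
    intro n
    induction n with
    | zero =>
      have hle : ∀ j, N (Fv m f (U 0 j)) ≤ a * (m + 1) * onenorm (Qr m f (U 0 j)) := by
        intro j
        rw [mul_assoc]
        exact (hNa _).trans (mul_le_mul_of_nonneg_left (onenorm_Fv_le m f _) ha.le)
      have hsm := hQ.mul_left (a * (m + 1))
      have hsm' : Summable fun j => N (Fv m f (U 0 j)) :=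
        Summable.of_nonneg_of_le (fun _ => h0 _) hle hsm
      refine ⟨hsm', (hsm'.tsum_le_tsum hle hsm).trans ?_⟩
      rw [tsum_mul_left, pow_zero, inv_one, one_mul]
      have : 0 ≤ P / (lam0 * s) := by positivity
      linarith
    | succ n ih =>
      have hsm := (ih.1.add ((htr n).1.mul_left G)).mul_left ρ⁻¹
      have hsm' : Summable fun j => N (Fv m f (U (n + 1) j)) :=
        Summable.of_nonneg_of_le (fun _ => h0 _) (hstep n) hsm
      refine ⟨hsm', (hsm'.tsum_le_tsum (hstep n) hsm).trans ?_⟩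
      rw [tsum_mul_left, ih.1.tsum_add ((htr n).1.mul_left G), tsum_mul_left]
      have x1 := mul_le_mul_of_nonneg_left (htr n).2 hG0
      have x2 : ρ⁻¹ * (∑' j, N (Fv m f (U n j)) + G * ∑' j, onenorm (Tr lam c (U n) j)) ≤
          ρ⁻¹ * ((ρ ^ n)⁻¹ * (a * (m + 1) * Q0) + P / (lam0 * s) + P) :=
        mul_le_mul_of_nonneg_left (by linarith [ih.2]) (by positivity)
      refine x2.trans (le_of_eq ?_)
      have x3 : P / (lam0 * s) + P = ρ * (P / (lam0 * s)) := by
        have : ρ = 1 + lam0 * s := by linarith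
        rw [this]
        field_simp
      rw [add_assoc, x3, mul_add, ← mul_assoc ρ⁻¹ ρ, inv_mul_cancel₀ hρ0.ne', one_mul, pow_succ,
        mul_inv]
      ring
  -- conclusion
  have hfin : ∀ j, onenorm (U (n + 1) j - U n j) ≤
      s * (2 * b) * N (Fv m f (U (n + 1) j)) + onenorm (Tr lam c (U n) j) := by
    intro j
    have e : U (n + 1) j - U n j = s • Qr m f (U (n + 1) j) - Tr lam c (U n) j := by
      funext i
      have := heq n j i
      simp only [Pi.sub_apply, Pi.smul_apply, smul_eq_mul]
      linarith
    rw [e]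
    refine (onenorm_sub_le _ _).trans (add_le_add ?_ le_rfl)
    rw [onenorm_smul, abs_of_pos hs0, mul_assoc]
    refine mul_le_mul_of_nonneg_left ((onenorm_Qr_le m f _).trans ?_) hs0.le
    have := hNb (Fv m f (U (n + 1) j))
    linarith
  have hsm := ((hF (n + 1)).1.mul_left (s * (2 * b))).add (htr n).1
  have hsm' : Summable fun j => onenorm (U (n + 1) j - U n j) :=
    Summable.of_nonneg_of_le (fun _ => onenorm_nonneg _) hfin hsm
  refine ⟨hsm', ?_⟩
  rw [tsum_mul_right, tsum_mul_right, ← hQ0]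
  have y1 := hsm'.tsum_le_tsum hfin hsm
  rw [((hF (n + 1)).1.mul_left (s * (2 * b))).tsum_add (htr n).1, tsum_mul_left] at y1
  have y2 := mul_le_mul_of_nonneg_left (hF (n + 1)).2 (show 0 ≤ s * (2 * b) by positivity)
  have y3 : ∑' j, onenorm (U (n + 1) j - U n j) ≤
      s * (2 * b) * ((ρ ^ (n + 1))⁻¹ * (a * (m + 1) * Q0) + P / (lam0 * s)) + c * (2 * L * T) := by
    linarith [(htr n).2]
  have y4 := mul_le_mul_of_nonneg_right y3 hx.le
  refine y4.trans ?_
  have hcx : c * Δx = Δt := by rw [hc]; field_simp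
  have z : (s * (2 * b) * ((ρ ^ (n + 1))⁻¹ * (a * (m + 1) * Q0) + P / (lam0 * s))
      + c * (2 * L * T)) * Δx = C1 * (s * (ρ ^ (n + 1))⁻¹ * (Q0 * Δx)) + C2 * Δt := by
    rw [← hcx, hC1, hC2, hP]
    field_simp
    ring
  rw [z]
  have hQp : 0 ≤ Q0 := tsum_nonneg fun _ => onenorm_nonneg _
  have w : 0 ≤ s * (ρ ^ (n + 1))⁻¹ * (Q0 * Δx) := by positivity
  nlinarith [mul_nonneg hC1p ht.le, mul_nonneg hC2p w]
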